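/- Let n ≥ 1 be an integer and let ξ ∈ ℝ^{n+1} have ℚ-linearly independent coordinates. Assume the setup of the functional transference theorem: S ⊆ ℤ^{n+1}, I an unbounded subinterval of (0,∞), A ∈ I, and continuous functions φ, ψ, θ : I → (0,∞) satisfying conditions (i)–(v). Then the functions Φ_0,…,Φ_{n−2} are all monotonically increasing, and there exists a constant c > 0 depending only on ξ (independent of S, I, A, φ, ψ, θ) such that Φ_{n−1}(X) ≥ c for every sufficiently large X. -/

import Mathlib

open Filter

/-- Euclidean norm of an integer point of `ℤ^{n+1}`. -/
noncomputable def inorm {n : ℕ} (x : Fin (n + 1) → ℤ) : ℝ :=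
  Real.sqrt (∑ k, ((x k : ℝ)) ^ 2)

/-- `L_ξ(x) = max_{1 ≤ k ≤ n} |ξ₀ x_k − ξ_k x₀|` (the term `k = 0` vanishes, so the
maximum over all `k` agrees with the maximum over `1 ≤ k ≤ n` when `n ≥ 1`). -/
noncomputable def Lxi {n : ℕ} (ξ : Fin (n + 1) → ℝ) (x : Fin (n + 1) → ℤ) : ℝ :=
  Finset.univ.sup' Finset.univ_nonempty fun k => |ξ 0 * (x k : ℝ) - ξ k * (x 0 : ℝ)|

/-- `𝓛_ξ(X; S) = min { L_ξ(x) : x ∈ S, 0 < ‖x‖ ≤ X }`, with the convention `min ∅ = ∞`. -/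
noncomputable def calL {n : ℕ} (ξ : Fin (n + 1) → ℝ) (S : Set (Fin (n + 1) → ℤ)) (X : ℝ) :
    ENNReal :=
  sInf { l | ∃ x ∈ S, x ≠ 0 ∧ inorm x ≤ X ∧ l = ENNReal.ofReal (Lxi ξ x) }

/-- `Φ_k(X) = X · φ(θ^k(X)) ⋯ φ(θ(X)) φ(X)` (so that `Φ_0(X) = X φ(X)`). -/
noncomputable def PhiFun (φ θ : ℝ → ℝ) (k : ℕ) (X : ℝ) : ℝ :=
  X * ∏ j ∈ Finset.range (k + 1), φ (θ^[j] X)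


noncomputable def PP (φ θ : ℝ → ℝ) (k : ℕ) (X : ℝ) : ℝ :=
  X * ∏ j ∈ Finset.range k, φ (θ^[j] X)

lemma PhiFun_eq (φ θ : ℝ → ℝ) (k : ℕ) : PhiFun φ θ k = PP φ θ (k + 1) := rfl

def mnr {m n : ℕ} (V : Fin m → Fin (n + 1) → ℤ) (J : Fin m → Fin (n + 1)) : ℤ :=
  (Matrix.of fun i l => V i (J l)).det

lemma mnr_cons {m n : ℕ} (y : Fin (n + 1) → ℤ) (V : Fin m → Fin (n + 1) → ℤ)
    (J : Fin (m + 1) → Fin (n + 1)) :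
    mnr (Fin.cons y V : Fin (m + 1) → Fin (n + 1) → ℤ) J
      = ∑ l : Fin (m + 1), (-1) ^ (l : ℕ) * mnr V (fun i => J (l.succAbove i)) * y (J l) := by
  unfold mnr
  rw [Matrix.det_succ_row_zero]
  refine Finset.sum_congr rfl fun l _ => ?_
  have : (Matrix.of fun i l => (Fin.cons y V : Fin (m + 1) → Fin (n + 1) → ℤ) i (J l)).submatrix
      Fin.succ l.succAbove = Matrix.of fun i k => V i (J (l.succAbove k)) := by
    ext i k; simp
  rw [this]
  simp only [Matrix.of_apply, Fin.cons_zero]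
  ring

lemma mnr_cons_self {m n : ℕ} (V : Fin m → Fin (n + 1) → ℤ) (i : Fin m)
    (J : Fin (m + 1) → Fin (n + 1)) :
    mnr (Fin.cons (V i) V : Fin (m + 1) → Fin (n + 1) → ℤ) J = 0 := by
  unfold mnr
  refine Matrix.det_zero_of_row_eq (i := 0) (j := i.succ) (Fin.succ_ne_zero i).symm ?_
  ext l; simp

lemma mnr_injective {m n : ℕ} (V : Fin m → Fin (n + 1) → ℤ)
    (J : Fin m → Fin (n + 1)) (h : mnr V J ≠ 0) : Function.Injective J := by
  intro a b hab
  by_contra hne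
  exact h (Matrix.det_zero_of_column_eq hne (fun k => by simp [hab]))

section basic
variable {n : ℕ} (ξ : Fin (n + 1) → ℝ)

lemma abs_le_Lxi (x : Fin (n + 1) → ℤ) (k : Fin (n + 1)) :
    |ξ 0 * (x k : ℝ) - ξ k * (x 0 : ℝ)| ≤ Lxi ξ x :=
  Finset.le_sup' (fun k => |ξ 0 * (x k : ℝ) - ξ k * (x 0 : ℝ)|) (Finset.mem_univ k)

lemma Lxi_nonneg (x : Fin (n + 1) → ℤ) : 0 ≤ Lxi ξ x :=
  (abs_nonneg _).trans (abs_le_Lxi ξ x 0)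

lemma abs_le_inorm (x : Fin (n + 1) → ℤ) (k : Fin (n + 1)) : |(x k : ℝ)| ≤ inorm x := by
  unfold inorm
  apply Real.abs_le_sqrt
  exact Finset.single_le_sum (f := fun k => ((x k : ℝ)) ^ 2) (fun i _ => sq_nonneg _)
    (Finset.mem_univ k)

lemma inorm_le_sum (x : Fin (n + 1) → ℤ) : inorm x ≤ ∑ k, |(x k : ℝ)| := by
  unfold inorm
  apply Real.sqrt_le_iff.2
  refine ⟨Finset.sum_nonneg fun i _ => abs_nonneg _, ?_⟩
  have := Finset.sum_sq_le_sq_sum_of_nonneg (s := Finset.univ) (f := fun k => |(x k : ℝ)|)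
    (fun i _ => abs_nonneg _)
  simpa using this

lemma one_le_abs_zero (x : Fin (n + 1) → ℤ) (hx : x ≠ 0) (hL : Lxi ξ x < |ξ 0|) :
    1 ≤ |(x 0 : ℝ)| := by
  have h0 : x 0 ≠ 0 := by
    intro h0
    apply hx
    ext k
    by_contra hk
    have h1 := abs_le_Lxi ξ x k
    rw [h0] at h1
    simp only [Int.cast_zero, mul_zero, sub_zero, abs_mul] at h1
    have h2 : (1 : ℝ) ≤ |(x k : ℝ)| := by exact_mod_cast Int.one_le_abs hk
    nlinarith [abs_nonneg (ξ 0)]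
  exact_mod_cast Int.one_le_abs h0

noncomputable def KK : ℝ := ∑ k, (|ξ k| + |ξ 0|) / |ξ 0|

lemma inorm_le_KK (h0 : ξ 0 ≠ 0) (x : Fin (n + 1) → ℤ) (hx : x ≠ 0) (hL : Lxi ξ x < |ξ 0|) :
    inorm x ≤ KK ξ * |(x 0 : ℝ)| := by
  refine (inorm_le_sum x).trans ?_
  unfold KK
  rw [Finset.sum_mul]
  refine Finset.sum_le_sum fun k _ => ?_
  have h1 := abs_le_Lxi ξ x k
  have h2 := one_le_abs_zero ξ x hx hL
  have hp : 0 < |ξ 0| := abs_pos.2 h0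
  rw [div_mul_eq_mul_div, le_div_iff₀ hp]
  have h3 : |ξ 0 * (x k : ℝ)| ≤ |ξ 0 * (x k : ℝ) - ξ k * (x 0 : ℝ)| + |ξ k * (x 0 : ℝ)| := by
    have := abs_add_le (ξ 0 * (x k : ℝ) - ξ k * (x 0 : ℝ)) (ξ k * (x 0 : ℝ))
    simpa using this
  rw [abs_mul, abs_mul] at h3
  nlinarith

lemma KK_nonneg : 0 ≤ KK ξ := Finset.sum_nonneg fun k _ => by positivity

lemma finite_bdd (X : ℝ) : {x : Fin (n + 1) → ℤ | inorm x ≤ X}.Finite := by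
  refine (Set.Finite.pi' (fun _ : Fin (n + 1) => Set.finite_Icc (-⌈X⌉) ⌈X⌉)).subset ?_
  intro x hx k
  have h1 := (abs_le_inorm x k).trans hx
  have h2 := h1.trans (Int.le_ceil X)
  have h3 : |x k| ≤ ⌈X⌉ := by exact_mod_cast h2
  exact abs_le.1 h3

lemma xi_ne (hξ : LinearIndependent ℚ ξ) : ξ 0 ≠ 0 := hξ.ne_zero 0

lemma form_ne (hξ : LinearIndependent ℚ ξ) {m : ℕ} (J : Fin m → Fin (n + 1))
    (hJ : Function.Injective J) (b : Fin m → ℤ) (hb : b ≠ 0) :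
    ∑ l, (b l : ℝ) * ξ (J l) ≠ 0 := by
  intro h
  have h1 := hξ.comp J hJ
  rw [Fintype.linearIndependent_iff] at h1
  apply hb
  ext l
  have := h1 (fun l => (b l : ℚ)) (by
    rw [← h]
    refine Finset.sum_congr rfl fun l _ => ?_
    simp [Rat.smul_def]) l
  exact_mod_cast this

lemma form_lb (hξ : LinearIndependent ℚ ξ) (m : ℕ) (B : ℝ) :
    ∃ δ : ℝ, 0 < δ ∧ ∀ (J : Fin m → Fin (n + 1)), Function.Injective J →
      ∀ b : Fin m → ℤ, b ≠ 0 → (∀ l, |(b l : ℝ)| ≤ B) → δ ≤ |∑ l, (b l : ℝ) * ξ (J l)| := by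
  set T : Set ((Fin m → Fin (n + 1)) × (Fin m → ℤ)) :=
    {p | Function.Injective p.1 ∧ p.2 ≠ 0 ∧ ∀ l, |(p.2 l : ℝ)| ≤ B} with hT
  have hfin : T.Finite := by
    refine ((Set.finite_univ (α := Fin m → Fin (n + 1))).prod
      (Set.Finite.pi' (fun _ : Fin m => Set.finite_Icc (-⌈B⌉) ⌈B⌉))).subset ?_
    rintro ⟨J, b⟩ ⟨-, -, h⟩
    refine ⟨trivial, fun l => ?_⟩
    have h2 := (h l).trans (Int.le_ceil B)
    have h3 : |b l| ≤ ⌈B⌉ := by exact_mod_cast h2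
    exact abs_le.1 h3
  by_cases hne : T.Nonempty
  · obtain ⟨p, hp, hmin⟩ := Set.exists_min_image T
      (fun p => |∑ l, (p.2 l : ℝ) * ξ (p.1 l)|) hfin hne
    exact ⟨_, abs_pos.2 (form_ne ξ hξ p.1 hp.1 p.2 hp.2.1),
      fun J hJ b hb hB => hmin (J, b) ⟨hJ, hb, hB⟩⟩
  · exact ⟨1, one_pos, fun J hJ b hb hB => (hne ⟨(J, b), hJ, hb, hB⟩).elim⟩

lemma escape (hξ : LinearIndependent ℚ ξ) (m : ℕ) (B : ℝ) :
    ∃ ε : ℝ, 0 < ε ∧ ∀ (J : Fin m → Fin (n + 1)), Function.Injective J →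
      ∀ b : Fin m → ℤ, b ≠ 0 → (∀ l, |(b l : ℝ)| ≤ B) →
      ∀ x : Fin (n + 1) → ℤ, x ≠ 0 → Lxi ξ x < ε → ∑ l, b l * x (J l) ≠ 0 := by
  obtain ⟨δ, hδ, h⟩ := form_lb ξ hξ m B
  have h0 := abs_pos.2 (xi_ne ξ hξ)
  have hq : 0 < m * |B| + 1 := by positivity
  refine ⟨min |ξ 0| (δ / (m * |B| + 1)), lt_min h0 (by positivity), ?_⟩
  intro J hJ b hb hB x hx hL hs
  have h1 := one_le_abs_zero ξ x hx (hL.trans_le (min_le_left _ _))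
  have h2 := h J hJ b hb hB
  have h3 : (∑ l, (b l : ℝ) * ξ (J l)) * x 0
      = - ∑ l, (b l : ℝ) * (ξ 0 * (x (J l) : ℝ) - ξ (J l) * (x 0 : ℝ)) := by
    have hs' : ∑ l, (b l : ℝ) * x (J l) = 0 := by exact_mod_cast hs
    have : ∑ l, (b l : ℝ) * (ξ 0 * (x (J l) : ℝ) - ξ (J l) * (x 0 : ℝ))
        = ξ 0 * (∑ l, (b l : ℝ) * x (J l)) - (∑ l, (b l : ℝ) * ξ (J l)) * x 0 := by
      rw [Finset.mul_sum, Finset.sum_mul, ← Finset.sum_sub_distrib]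
      exact Finset.sum_congr rfl fun l _ => by ring
    rw [this, hs']; ring
  have h4 : |(∑ l, (b l : ℝ) * ξ (J l)) * x 0| ≤ m * |B| * Lxi ξ x := by
    rw [h3, abs_neg]
    refine (Finset.abs_sum_le_sum_abs _ _).trans ?_
    calc _ ≤ ∑ l : Fin m, |B| * Lxi ξ x := by
          refine Finset.sum_le_sum fun l _ => ?_
          rw [abs_mul]
          exact mul_le_mul ((hB l).trans (le_abs_self B)) (abs_le_Lxi ξ x _) (abs_nonneg _)
            (abs_nonneg _)
      _ = _ := by simp [mul_assoc]
  rw [abs_mul] at h4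
  have h5 : Lxi ξ x < δ / (m * |B| + 1) := hL.trans_le (min_le_right _ _)
  rw [lt_div_iff₀ hq] at h5
  have h6 := Lxi_nonneg ξ x
  nlinarith [abs_nonneg (∑ l, (b l : ℝ) * ξ (J l))]

/-- consecutive points are nearly parallel -/
lemma near_parallel (h0 : ξ 0 ≠ 0) (x y : Fin (n + 1) → ℤ) (hx : x ≠ 0)
    (hL : Lxi ξ x < |ξ 0|) (hyx : Lxi ξ y ≤ Lxi ξ x)
    (hxy : inorm x ≤ inorm y) (k : Fin (n + 1)) :
    |(y k : ℝ) - (y 0 : ℝ) / (x 0 : ℝ) * (x k : ℝ)|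
      ≤ (1 + KK ξ) / |ξ 0| * (inorm y * Lxi ξ x / inorm x) := by
  have hp : 0 < |ξ 0| := abs_pos.2 h0
  have h1 := one_le_abs_zero ξ x hx hL
  have hx0 : (x 0 : ℝ) ≠ 0 := by intro h; rw [h] at h1; simp at h1; linarith
  have hX := inorm_le_KK ξ h0 x hx hL
  have hXpos : 0 < inorm x := by linarith [abs_le_inorm x 0]
  have hLx := Lxi_nonneg ξ x
  have key : ξ 0 * ((y k : ℝ) - (y 0 : ℝ) / (x 0 : ℝ) * (x k : ℝ))
      = (ξ 0 * y k - ξ k * y 0) - (y 0 : ℝ) / (x 0 : ℝ) * (ξ 0 * x k - ξ k * x 0) := by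
    field_simp; ring
  have h2 : |(y 0 : ℝ) / (x 0 : ℝ)| ≤ KK ξ * (inorm y / inorm x) := by
    rw [abs_div, div_le_iff₀ (by linarith), mul_div_assoc', div_mul_eq_mul_div, le_div_iff₀ hXpos]
    have := abs_le_inorm y 0
    nlinarith [abs_nonneg (y 0 : ℝ)]
  have h3 : 1 ≤ inorm y / inorm x := (one_le_div hXpos).2 hxy
  have h4 : |ξ 0| * |(y k : ℝ) - (y 0 : ℝ) / (x 0 : ℝ) * (x k : ℝ)|
      ≤ (1 + KK ξ) * (inorm y / inorm x) * Lxi ξ x := by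
    rw [← abs_mul, key]
    refine (abs_sub _ _).trans ?_
    rw [abs_mul]
    have a1 := (abs_le_Lxi ξ y k).trans hyx
    have a2 := abs_le_Lxi ξ x k
    have a3 := mul_le_mul h2 a2 (abs_nonneg _) (by have := KK_nonneg ξ; positivity)
    nlinarith
  have e : (1 + KK ξ) / |ξ 0| * (inorm y * Lxi ξ x / inorm x)
    = ((1 + KK ξ) * (inorm y / inorm x) * Lxi ξ x) / |ξ 0| := by field_simp
  rw [e, le_div_iff₀ hp]
  linarith
end basic

lemma escape_minor {n : ℕ} (ξ : Fin (n + 1) → ℝ) (hξ : LinearIndependent ℚ ξ) (k : ℕ)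
    (hk : k + 1 ≤ n) (B : ℝ) :
    ∃ ε : ℝ, 0 < ε ∧ ∀ V : Fin (k + 1) → Fin (n + 1) → ℤ, (∃ J, mnr V J ≠ 0) →
      (∀ J, |(mnr V J : ℝ)| ≤ B) → ∀ y : Fin (n + 1) → ℤ, y ≠ 0 → Lxi ξ y < ε →
      ∃ J, mnr (Fin.cons y V : Fin (k + 2) → Fin (n + 1) → ℤ) J ≠ 0 := by
  obtain ⟨ε, hε, h⟩ := escape ξ hξ (k + 2) B
  refine ⟨ε, hε, ?_⟩
  rintro V ⟨J, hJ⟩ hB y hy hL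
  have hinj := mnr_injective V J hJ
  obtain ⟨c, hc⟩ : ∃ c, c ∉ Set.range J := by
    by_contra hcon
    push Not at hcon
    have := Fintype.card_le_of_surjective J hcon
    simp at this
    omega
  set J' : Fin (k + 2) → Fin (n + 1) := Fin.cons c J with hJ'
  have hinj' : Function.Injective J' := Fin.cons_injective_iff.2 ⟨hc, hinj⟩
  refine ⟨J', ?_⟩
  rw [mnr_cons]
  refine h J' hinj' _ ?_ ?_ y hy hL
  · intro h0
    have := congrFun h0 0
    simp [hJ'] at this
    exact hJ this
  · intro l
    push_cast
    rw [abs_mul, abs_pow]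
    simpa using hB _

lemma build {n : ℕ} (ξ : Fin (n + 1) → ℝ) (hξ : LinearIndependent ℚ ξ)
    (x : ℕ → Fin (n + 1) → ℤ) (hx0 : ∀ i, x i ≠ 0) (hmono : Monotone fun i => inorm (x i))
    (hanti : Antitone fun i => Lxi ξ (x i)) (hsm : Lxi ξ (x 0) < |ξ 0|)
    (htend : ∀ η > 0, ∃ M, ∀ i ≥ M, Lxi ξ (x i) < η)
    (F : ℕ → ℝ → ℝ) (hF0 : ∀ X, F 0 X = X) (k : ℕ) (hk : k ≤ n)
    (hstep : ∀ l < k, ∀ N j, N ≤ j →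
      inorm (x (j + 1)) * Lxi ξ (x j) / inorm (x j) * F l (inorm (x N))
        ≤ F (l + 1) (inorm (x (j + 1)))) :
    ∃ (N : ℕ) (V : Fin (k + 1) → Fin (n + 1) → ℤ), (∃ i, V i = x 0) ∧ (∃ J, mnr V J ≠ 0) ∧
      (∀ J, mnr (Fin.cons (x N) V : Fin (k + 2) → Fin (n + 1) → ℤ) J = 0) ∧
      ∀ J, |(mnr V J : ℝ)| ≤ ((n + 1) * ((1 + KK ξ) / |ξ 0|)) ^ k * F k (inorm (x N)) := by
  have hξ0 := xi_ne ξ hξ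
  have hp : 0 < |ξ 0| := abs_pos.2 hξ0
  have hK := KK_nonneg ξ
  induction k with
  | zero =>
    have e : ∀ J, mnr (fun _ : Fin 1 => x 0) J = x 0 (J 0) := by
      intro J; simp [mnr]
    refine ⟨0, fun _ => x 0, ⟨0, rfl⟩, ?_, ?_, ?_⟩
    · obtain ⟨c, hc⟩ := Function.ne_iff.1 (hx0 0)
      exact ⟨fun _ => c, by rw [e]; exact hc⟩
    · intro J
      exact mnr_cons_self (fun _ : Fin 1 => x 0) 0 J
    · intro J
      rw [e, hF0]
      simpa using abs_le_inorm (x 0) (J 0)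
  | succ k ih =>
    obtain ⟨N, V, ⟨i0, hi0⟩, hJ, hN, hB⟩ := ih (by omega) (fun l hl => hstep l (by omega))
    set B := ((n + 1) * ((1 + KK ξ) / |ξ 0|)) ^ k * F k (inorm (x N)) with hBdef
    obtain ⟨ε, hε, hesc⟩ := escape_minor ξ hξ k hk B
    obtain ⟨M, hM⟩ := htend ε hε
    -- first index after N that is outside
    have hex : ∃ d, ∃ J, mnr (Fin.cons (x (N + d)) V : Fin (k + 2) → Fin (n + 1) → ℤ) J ≠ 0 :=
      ⟨M, hesc V hJ hB _ (hx0 _) (hM _ (by omega))⟩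
    classical
    obtain ⟨j, hNj, hjin, hjout⟩ : ∃ j, N ≤ j ∧
        (∀ J, mnr (Fin.cons (x j) V : Fin (k + 2) → Fin (n + 1) → ℤ) J = 0) ∧
        ∃ J, mnr (Fin.cons (x (j + 1)) V : Fin (k + 2) → Fin (n + 1) → ℤ) J ≠ 0 := by
      have hs := Nat.find_spec hex
      have hm := fun d hd => Nat.find_min hex (m := d) hd
      rcases hd : Nat.find hex with _ | d
      · rw [hd] at hs
        obtain ⟨J, hJ⟩ := hs
        exact (hJ (hN J)).elim
      · rw [hd] at hs hm
        refine ⟨N + d, by omega, ?_, hs⟩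
        have := hm d (by omega)
        push Not at this
        exact this
    refine ⟨j + 1, Fin.cons (x (j + 1)) V, ⟨i0.succ, by simpa using hi0⟩, hjout, ?_, ?_⟩
    · intro J
      have := mnr_cons_self (Fin.cons (x (j + 1)) V : Fin (k + 2) → Fin (n + 1) → ℤ) 0 J
      simpa using this
    · intro J
      have hLj : Lxi ξ (x j) < |ξ 0| := (hanti (Nat.zero_le j)).trans_lt hsm
      have hw := near_parallel ξ hξ0 (x j) (x (j + 1)) (hx0 j) hLj (hanti (Nat.le_succ j))
        (hmono (Nat.le_succ j))
      set W := inorm (x (j + 1)) * Lxi ξ (x j) / inorm (x j) with hW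
      have hst := hstep k (by omega) N j hNj
      set α := ((x (j + 1) 0 : ℝ)) / (x j 0 : ℝ) with hα
      have e1 : (mnr (Fin.cons (x (j + 1)) V : Fin (k + 2) → Fin (n + 1) → ℤ) J : ℝ)
          = ∑ l : Fin (k + 2), ((-1) ^ (l : ℕ) * mnr V (fun i => J (l.succAbove i)) : ℝ)
            * (x (j + 1) (J l) - α * x j (J l)) := by
        have h1 := mnr_cons (x (j + 1)) V J
        have h2 := mnr_cons (x j) V J
        rw [hjin J] at h2
        have h2' : (0 : ℝ) = ∑ l : Fin (k + 2),
            ((-1) ^ (l : ℕ) * mnr V (fun i => J (l.succAbove i)) : ℝ) * x j (J l) := by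
          exact_mod_cast h2
        rw [h1]
        push_cast
        have : ∀ a : ℝ, a = a - α * 0 := by intro a; ring
        rw [this (∑ _, _), h2', Finset.mul_sum, ← Finset.sum_sub_distrib]
        exact Finset.sum_congr rfl fun l _ => by ring
      rw [e1]
      have hB0 : 0 ≤ B := (abs_nonneg _).trans (hB fun _ => 0)
      have hW0 : 0 ≤ W := by
        have := Lxi_nonneg ξ (x j)
        have a1 : 0 ≤ inorm (x (j + 1)) := Real.sqrt_nonneg _
        have a2 : 0 ≤ inorm (x j) := Real.sqrt_nonneg _
        positivity
      calc |∑ l : Fin (k + 2), ((-1) ^ (l : ℕ) * mnr V (fun i => J (l.succAbove i)) : ℝ)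
            * (x (j + 1) (J l) - α * x j (J l))|
          ≤ ∑ l : Fin (k + 2), B * ((1 + KK ξ) / |ξ 0| * W) := by
            refine (Finset.abs_sum_le_sum_abs _ _).trans (Finset.sum_le_sum fun l _ => ?_)
            rw [abs_mul, abs_mul, abs_pow, abs_neg, abs_one, one_pow, one_mul]
            exact mul_le_mul (hB _) (hw _) (abs_nonneg _) hB0
        _ = (k + 2 : ℝ) * (B * ((1 + KK ξ) / |ξ 0| * W)) := by simp
        _ ≤ (n + 1 : ℝ) * (B * ((1 + KK ξ) / |ξ 0| * W)) := by
            have : (k + 1 : ℝ) ≤ n := by exact_mod_cast hk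
            apply mul_le_mul_of_nonneg_right (by linarith) (by positivity)
        _ = ((n + 1) * ((1 + KK ξ) / |ξ 0|)) ^ (k + 1) * (W * F k (inorm (x N))) := by
            rw [hBdef]; ring
        _ ≤ _ := mul_le_mul_of_nonneg_left hst (by positivity)

lemma exists_seq {n : ℕ} (ξ : Fin (n + 1) → ℝ) (S : Set (Fin (n + 1) → ℤ)) (A : ℝ)
    (φ ψ : ℝ → ℝ) (hφc : ContinuousOn φ (Set.Ici A))
    (hψ : ∀ X, A ≤ X → 0 < ψ X)
    (hL : ∀ X : ℝ, A ≤ X →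
          ENNReal.ofReal (ψ X) ≤ calL ξ S X ∧ calL ξ S X ≤ ENNReal.ofReal (φ X))
    (hφ0 : Filter.Tendsto φ Filter.atTop (nhds 0)) (hφ : ∀ X, A ≤ X → 0 < φ X)
    (A' : ℝ) (hA' : A ≤ A') (ε : ℝ) (hε : 0 < ε) :
    ∃ x : ℕ → Fin (n + 1) → ℤ, (∀ i, x i ≠ 0) ∧ (∀ i, A' < inorm (x i)) ∧
      (Monotone fun i => inorm (x i)) ∧ (Antitone fun i => Lxi ξ (x i)) ∧ Lxi ξ (x 0) < ε ∧
      (∀ η > 0, ∃ M, ∀ i ≥ M, Lxi ξ (x i) < η) ∧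
      (∀ i, Lxi ξ (x i) ≤ φ (inorm (x (i + 1)))) ∧
      ∀ i, ψ (inorm (x i)) ≤ Lxi ξ (x i) := by
  have h1 : ∀ x ∈ S, x ≠ 0 → ∀ X, A ≤ X → inorm x ≤ X → ψ X ≤ Lxi ξ x := by
    intro x hx hx0 X hX hxX
    have : calL ξ S X ≤ ENNReal.ofReal (Lxi ξ x) := sInf_le ⟨x, hx, hx0, hxX, rfl⟩
    exact (ENNReal.ofReal_le_ofReal_iff (Lxi_nonneg ξ x)).1 ((hL X hX).1.trans this)
  have h2 : ∀ X, A ≤ X → ∃ x ∈ S, x ≠ 0 ∧ inorm x ≤ X ∧ Lxi ξ x ≤ φ X := by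
    intro X hX
    have hle := (hL X hX).2
    have hfin : { l | ∃ x ∈ S, x ≠ 0 ∧ inorm x ≤ X ∧ l = ENNReal.ofReal (Lxi ξ x) }.Finite := by
      refine ((finite_bdd (n := n) X).image fun x => ENNReal.ofReal (Lxi ξ x)).subset ?_
      rintro l ⟨x, -, -, h, rfl⟩
      exact ⟨x, h, rfl⟩
    unfold calL at hle
    rcases Set.eq_empty_or_nonempty
      { l | ∃ x ∈ S, x ≠ 0 ∧ inorm x ≤ X ∧ l = ENNReal.ofReal (Lxi ξ x) } with h | h
    · rw [h, sInf_empty] at hle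
      exact (ENNReal.ofReal_ne_top (top_le_iff.1 hle)).elim
    · obtain ⟨x, a, b, c, d⟩ := h.csInf_mem hfin
      rw [d] at hle
      exact ⟨x, a, b, c, (ENNReal.ofReal_le_ofReal_iff (hφ X hX).le).1 hle⟩
  have h3 : ∀ η > 0, ∃ x ∈ S, x ≠ 0 ∧ Lxi ξ x < η := by
    intro η hη
    obtain ⟨X, hX1, hX2⟩ := ((hφ0.eventually (gt_mem_nhds hη)).and
      (Filter.eventually_ge_atTop A)).exists
    obtain ⟨x, a, b, -, c⟩ := h2 X hX2
    exact ⟨x, a, b, c.trans_lt hX1⟩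
  have h4 : ∀ η : ℝ, ∃ x : Fin (n + 1) → ℤ, 0 < η → x ∈ S ∧ x ≠ 0 ∧ Lxi ξ x < η ∧
      ∀ y ∈ S, y ≠ 0 → Lxi ξ y < η → inorm x ≤ inorm y := by
    intro η
    by_cases hη : 0 < η
    · obtain ⟨y, a, b, c⟩ := h3 η hη
      obtain ⟨x, hx, hmin⟩ := Set.exists_min_image
        {x : Fin (n + 1) → ℤ | inorm x ≤ inorm y ∧ x ∈ S ∧ x ≠ 0 ∧ Lxi ξ x < η} inorm
        ((finite_bdd (inorm y)).subset fun x hx => hx.1) ⟨y, le_rfl, a, b, c⟩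
      refine ⟨x, fun _ => ⟨hx.2.1, hx.2.2.1, hx.2.2.2, fun z hz hz0 hzL => ?_⟩⟩
      rcases le_total (inorm z) (inorm y) with h | h
      · exact hmin z ⟨h, hz, hz0, hzL⟩
      · exact hx.1.trans h
    · exact ⟨0, fun h => (hη h).elim⟩
  have hpos : ∀ x ∈ S, x ≠ 0 → 0 < Lxi ξ x := fun x hx hx0 =>
    (hψ _ (le_max_left A (inorm x))).trans_le (h1 x hx hx0 _ (le_max_left _ _) (le_max_right _ _))
  choose g hg using h4
  set ε0 := min ε (ψ A') with hε0
  have hε0p : 0 < ε0 := lt_min hε (hψ A' hA')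
  set x : ℕ → Fin (n + 1) → ℤ := fun i => Nat.rec (g ε0) (fun _ y => g (Lxi ξ y)) i with hxdef
  have hx0 : x 0 = g ε0 := rfl
  have hxs : ∀ i, x (i + 1) = g (Lxi ξ (x i)) := fun i => rfl
  clear_value x
  have hmem : ∀ i, x i ∈ S ∧ x i ≠ 0 := by
    intro i
    induction i with
    | zero => rw [hx0]; exact ⟨(hg ε0 hε0p).1, (hg ε0 hε0p).2.1⟩
    | succ i ih =>
      have := hg _ (hpos _ ih.1 ih.2)
      rw [hxs]; exact ⟨this.1, this.2.1⟩
  have hp : ∀ i, 0 < Lxi ξ (x i) := fun i => hpos _ (hmem i).1 (hmem i).2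
  have hlt : ∀ i, Lxi ξ (x (i + 1)) < Lxi ξ (x i) := by
    intro i; rw [hxs]; exact (hg _ (hp i)).2.2.1
  have hmin : ∀ i, ∀ y ∈ S, y ≠ 0 → Lxi ξ y < Lxi ξ (x i) → inorm (x (i + 1)) ≤ inorm y := by
    intro i; rw [hxs]; exact (hg _ (hp i)).2.2.2
  have hanti : StrictAnti fun i => Lxi ξ (x i) := strictAnti_nat_of_succ_lt hlt
  have hmono : Monotone fun i => inorm (x i) := by
    refine monotone_nat_of_le_succ fun i => ?_
    cases i with
    | zero =>
      have := (hg _ hε0p).2.2.2 (x 1) (hmem 1).1 (hmem 1).2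
        ((hlt 0).trans (by rw [hx0]; exact (hg _ hε0p).2.2.1))
      rw [← hx0] at this
      exact this
    | succ i => exact hmin i _ (hmem (i + 2)).1 (hmem (i + 2)).2 ((hlt (i + 1)).trans (hlt i))
  have hL0 : Lxi ξ (x 0) < ε0 := by rw [hx0]; exact (hg _ hε0p).2.2.1
  have hbig0 : A' < inorm (x 0) := by
    by_contra hcon
    push Not at hcon
    have := h1 (x 0) (hmem 0).1 (hmem 0).2 A' hA' hcon
    exact absurd (hL0.trans_le (min_le_right _ _)) (not_lt.2 this)
  have hbig : ∀ i, A' < inorm (x i) := fun i => hbig0.trans_le (hmono (Nat.zero_le i))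
  refine ⟨x, fun i => (hmem i).2, hbig, hmono, hanti.antitone, hL0.trans_le (min_le_left _ _),
    ?_, ?_, ?_⟩
  · intro η hη
    by_contra hcon
    push Not at hcon
    have hall : ∀ i, η ≤ Lxi ξ (x i) := by
      intro i
      obtain ⟨j, hj, hj'⟩ := hcon i
      exact hj'.trans (hanti.antitone hj)
    obtain ⟨y, a, b, c⟩ := h3 η hη
    have hb : ∀ i, inorm (x i) ≤ inorm y := fun i =>
      (hmono (Nat.le_succ i)).trans (hmin i y a b (c.trans_le (hall i)))
    have hinj : Function.Injective x := fun i j hij => hanti.injective (by simp [hij])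
    exact Set.infinite_of_injective_forall_mem hinj hb (finite_bdd (inorm y))
  · intro i
    have hY : A < inorm (x (i + 1)) := hA'.trans_lt (hbig _)
    have hev : ∀ X ∈ Set.Ico A (inorm (x (i + 1))), Lxi ξ (x i) ≤ φ X := by
      intro X hX
      obtain ⟨y, a, b, c, d⟩ := h2 X hX.1
      by_contra hcon
      push Not at hcon
      have := hmin i y a b (d.trans_lt hcon)
      exact absurd (c.trans_lt hX.2) (not_lt.2 this)
    have ht : Filter.Tendsto φ (nhdsWithin (inorm (x (i + 1))) (Set.Ico A (inorm (x (i + 1)))))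
        (nhds (φ (inorm (x (i + 1))))) :=
      (hφc _ hY.le).mono_left (nhdsWithin_mono _ fun z hz => hz.1)
    haveI := right_nhdsWithin_Ico_neBot hY
    exact ge_of_tendsto ht (Filter.eventually_of_mem self_mem_nhdsWithin hev)
  · intro i
    exact h1 _ (hmem i).1 (hmem i).2 _ (hA'.trans (hbig i).le) le_rfl
/-- Theorem 1.3 (main transference principle): under the hypotheses (i)–(v), the functions
`Φ_0, …, Φ_{n−2}` are monotonically increasing, and `Φ_{n−1}(X) ≥ c` for all large `X`,
where `c > 0` depends only on `ξ`. -/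
theorem functional_transference (n : ℕ) (hn : 1 ≤ n) (ξ : Fin (n + 1) → ℝ)
    (hξ : LinearIndependent ℚ ξ) :
    ∃ c : ℝ, 0 < c ∧
      ∀ (S : Set (Fin (n + 1) → ℤ)) (I : Set ℝ),
        I ⊆ Set.Ioi 0 → I.OrdConnected → ¬ BddAbove I →
        ∀ A ∈ I, ∀ φ ψ θ : ℝ → ℝ,
        ContinuousOn φ I → ContinuousOn ψ I → ContinuousOn θ I →
        (∀ X ∈ I, 0 < φ X) → (∀ X ∈ I, 0 < ψ X) → (∀ X ∈ I, 0 < θ X) →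
        (∀ X : ℝ, A ≤ X →
          ENNReal.ofReal (ψ X) ≤ calL ξ S X ∧ calL ξ S X ≤ ENNReal.ofReal (φ X)) →
        StrictAntiOn φ I → StrictAntiOn ψ I → MonotoneOn θ I →
        Filter.Tendsto φ Filter.atTop (nhds 0) →
        Filter.Tendsto ψ Filter.atTop (nhds 0) →
        Filter.Tendsto θ Filter.atTop Filter.atTop →
        (∀ k : ℕ, 1 ≤ k → k ≤ n - 1 → ∀ X : ℝ, A ≤ X → θ^[k] X ∈ I) →
        (∀ X : ℝ, A ≤ X → φ X = ψ (θ X)) →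
        MonotoneOn (PhiFun φ θ 0) (Set.Ici A) →
        (∀ k : ℕ, 1 ≤ k → k ≤ n - 1 →
          MonotoneOn (PhiFun φ θ k) (Set.Ici A) ∨ AntitoneOn (PhiFun φ θ k) (Set.Ici A)) →
        (∀ k : ℕ, k + 2 ≤ n → MonotoneOn (PhiFun φ θ k) (Set.Ici A)) ∧
        (∀ᶠ X : ℝ in Filter.atTop, c ≤ PhiFun φ θ (n - 1) X) := by
  have hξ0 := xi_ne ξ hξ
  have hp : 0 < |ξ 0| := abs_pos.2 hξ0
  have hK := KK_nonneg ξ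
  set C : ℝ := (n + 1) * ((1 + KK ξ) / |ξ 0|) with hC
  have hCpos : 0 < C := by positivity
  refine ⟨1 / C ^ n, by positivity, ?_⟩
  intro S I hI0 hIc hIu A hA φ ψ θ hφc hψc hθc hφp hψp hθp hL hφa hψa hθm hφ0 hψ0 hθ0 hθI hφψ
    hΦ0 hΦ
  have hIci : ∀ X, A ≤ X → X ∈ I := by
    intro X hX
    rw [not_bddAbove_iff] at hIu
    obtain ⟨Y, hY, hXY⟩ := hIu X
    exact hIc.out hA hY ⟨hX, hXY.le⟩
  have hApos : 0 < A := hI0 hA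
  have hitI : ∀ k, k ≤ n - 1 → ∀ X, A ≤ X → θ^[k] X ∈ I := by
    intro k hk X hX
    rcases Nat.eq_zero_or_pos k with rfl | h
    · exact hIci X hX
    · exact hθI k h hk X hX
  -- the step inequality
  have hstep : ∀ x : ℕ → Fin (n + 1) → ℤ, (∀ i, A < inorm (x i)) →
      (Monotone fun i => inorm (x i)) → (∀ i, Lxi ξ (x i) ≤ φ (inorm (x (i + 1)))) →
      (∀ i, ψ (inorm (x i)) ≤ Lxi ξ (x i)) →
      ∀ l < n, MonotoneOn (PP φ θ l) (Set.Ici A) → ∀ N j, N ≤ j →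
      inorm (x (j + 1)) * Lxi ξ (x j) / inorm (x j) * PP φ θ l (inorm (x N))
        ≤ PP φ θ (l + 1) (inorm (x (j + 1))) := by
    intro x hbig hmono h1 h2 l hl hm N j hNj
    have hAj := hbig j
    have hAj1 := hbig (j + 1)
    have hA1 := h1 j
    have hA2 := h2 j
    have hle := hm (hbig N).le hAj.le (hmono hNj)
    set X := inorm (x (j + 1)) with hX
    set Y := inorm (x j) with hY
    have hYpos : 0 < Y := hApos.trans hAj
    have hXpos : 0 < X := hApos.trans hAj1
    have hLn := Lxi_nonneg ξ (x j)
    have hit : ∀ i < l, θ^[i + 1] X ≤ θ^[i] Y := by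
      intro i
      induction i with
      | zero =>
        intro h
        by_contra hcon
        push Not at hcon
        have hin : θ X ∈ I := hitI 1 (by omega) X hAj1.le
        have := hψa (hIci Y hAj.le) hin (by simpa using hcon)
        rw [← hφψ X hAj1.le] at this
        linarith
      | succ i ih =>
        intro h
        rw [Function.iterate_succ_apply', Function.iterate_succ_apply' θ i Y]
        exact hθm (hitI _ (by omega) X hAj1.le) (hitI _ (by omega) Y hAj.le) (ih (by omega))
    have hprod : ∏ i ∈ Finset.range l, φ (θ^[i] Y) ≤ ∏ i ∈ Finset.range l, φ (θ^[i + 1] X) := by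
      refine Finset.prod_le_prod (fun i hi => ?_) (fun i hi => ?_)
      · have := Finset.mem_range.1 hi
        exact (hφp _ (hitI i (by omega) Y hAj.le)).le
      · have := Finset.mem_range.1 hi
        exact hφa.antitoneOn (hitI _ (by omega) X hAj1.le) (hitI _ (by omega) Y hAj.le) (hit i this)
    have hprod0 : 0 ≤ ∏ i ∈ Finset.range l, φ (θ^[i] Y) :=
      Finset.prod_nonneg fun i hi =>
        (hφp _ (hitI i (by have := Finset.mem_range.1 hi; omega) Y hAj.le)).le
    calc X * Lxi ξ (x j) / Y * PP φ θ l (inorm (x N))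
        ≤ X * Lxi ξ (x j) / Y * PP φ θ l Y := mul_le_mul_of_nonneg_left hle (by positivity)
      _ = X * ((∏ i ∈ Finset.range l, φ (θ^[i] Y)) * Lxi ξ (x j)) := by
          unfold PP; field_simp
      _ ≤ X * ((∏ i ∈ Finset.range l, φ (θ^[i + 1] X)) * φ X) := by
          refine mul_le_mul_of_nonneg_left ?_ hXpos.le
          exact mul_le_mul hprod hA1 hLn (hprod0.trans hprod)
      _ = PP φ θ (l + 1) X := by
          unfold PP; rw [Finset.prod_range_succ']; simp
  have hφci : ContinuousOn φ (Set.Ici A) := hφc.mono fun X hX => hIci X hX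
  have hseq := exists_seq ξ S A φ ψ hφci (fun X hX => hψp X (hIci X hX)) hL hφ0
    (fun X hX => hφp X (hIci X hX))
  have hmain : ∀ k ≤ n, (∀ l < k, MonotoneOn (PP φ θ l) (Set.Ici A)) → ∀ A', A ≤ A' →
      ∀ ε > 0, ∃ (Y : ℝ) (y : Fin (n + 1) → ℤ) (V : Fin (k + 1) → Fin (n + 1) → ℤ), A' < Y ∧
        y ≠ 0 ∧ Lxi ξ y < ε ∧ (∃ i, V i = y) ∧ (∃ J, mnr V J ≠ 0) ∧
        ∀ J, |(mnr V J : ℝ)| ≤ C ^ k * PP φ θ k Y := by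
    intro k hk hm A' hA' ε hε
    obtain ⟨x, a1, a2, a3, a4, a5, a6, a7, a8⟩ := hseq A' hA' (min ε |ξ 0|) (lt_min hε hp)
    obtain ⟨N, V, b1, b2, -, b4⟩ := build ξ hξ x a1 a3 a4 (a5.trans_le (min_le_right _ _)) a6
      (PP φ θ) (fun X => by simp [PP]) k hk (fun l hl => hstep x (fun i => hA'.trans_lt (a2 i)) a3 a7
        a8 l (by omega) (hm l hl))
    exact ⟨inorm (x N), x 0, V, a2 N, a1 0, a5.trans_le (min_le_left _ _), b1, b2, b4⟩
  have hmono : ∀ k < n, MonotoneOn (PP φ θ k) (Set.Ici A) := by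
    intro k
    induction k using Nat.strong_induction_on with
    | _ k ih =>
      intro hk
      match k, ih, hk with
      | 0, _, _ => intro a _ b _ hab; simpa [PP] using hab
      | 1, _, _ => exact hΦ0
      | k + 2, ih, hk =>
        rcases hΦ (k + 1) (by omega) (by omega) with h | h
        · exact h
        · exfalso
          obtain ⟨ε, hε, hesc⟩ := escape_minor ξ hξ (k + 2) (by omega)
            (C ^ (k + 2) * PP φ θ (k + 2) A)
          obtain ⟨Y, y, V, hY, hy, hyL, ⟨i, hi⟩, hJ, hB⟩ := hmain (k + 2) hk.le
            (fun l hl => ih l hl (hl.trans hk)) A le_rfl ε hε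
          have hle : PP φ θ (k + 2) Y ≤ PP φ θ (k + 2) A := h (le_refl A) hY.le hY.le
          obtain ⟨J', hJ'⟩ := hesc V hJ (fun J => (hB J).trans
            (mul_le_mul_of_nonneg_left hle (by positivity))) y hy hyL
          rw [← hi] at hJ'
          exact hJ' (mnr_cons_self V i J')
  refine ⟨fun k hk => hmono (k + 1) (by omega), ?_⟩
  have hn1 : n - 1 + 1 = n := by omega
  rw [PhiFun_eq, hn1]
  have hlow : ∀ A', A ≤ A' → ∃ Y, A' < Y ∧ 1 / C ^ n ≤ PP φ θ n Y := by
    intro A' hA'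
    obtain ⟨Y, y, V, hY, -, -, -, ⟨J, hJ⟩, hB⟩ := hmain n le_rfl hmono A' hA' 1 one_pos
    refine ⟨Y, hY, ?_⟩
    rw [div_le_iff₀ (by positivity)]
    have h1 : (1 : ℝ) ≤ |(mnr V J : ℝ)| := by exact_mod_cast Int.one_le_abs hJ
    linarith [hB J]
  have hmon : MonotoneOn (PP φ θ n) (Set.Ici A) ∨ AntitoneOn (PP φ θ n) (Set.Ici A) := by
    rw [← hn1, ← PhiFun_eq]
    rcases Nat.eq_zero_or_pos (n - 1) with h | h
    · rw [h]; exact Or.inl hΦ0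
    · exact hΦ (n - 1) h le_rfl
  rcases hmon with h | h
  · obtain ⟨Y, hY, hYc⟩ := hlow A le_rfl
    filter_upwards [Filter.eventually_ge_atTop Y] with X hX
    exact hYc.trans (h hY.le (hY.le.trans hX) hX)
  · filter_upwards [Filter.eventually_ge_atTop A] with X hX
    obtain ⟨Y, hY, hYc⟩ := hlow X hX
    exact hYc.trans (h hX (hX.trans hY.le) hY.le)
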